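/- Let κ satisfy the energy, consistency, and domination principles. Then for every μ ∈ E⁺ and every set A ⊂ X, the inner balayage μ^A is the unique measure in E'_A minimizing the strong distance to μ, and moreover ‖μ − μ^A‖ = min_{ν ∈ E'_A} ‖μ − ν‖ = inf_{ν ∈ E⁺_A} ‖μ − ν‖; that is, μ^A is the orthogonal projection of μ onto the strongly closed convex cone E'_A. -/

import Mathlib

open MeasureTheory Filter Topology Set
open scoped ENNReal NNReal

namespace Balayage

variable {X : Type*} [TopologicalSpace X] [T2Space X] [LocallyCompactSpace X]
  [MeasurableSpace X] [BorelSpace X]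

/-- The potential `κμ(x) := ∫ κ(x,y) dμ(y)`. -/
noncomputable def pot (κ : X → X → ℝ≥0∞) (μ : Measure X) (x : X) : ℝ≥0∞ :=
  ∫⁻ y, κ x y ∂μ

/-- The mutual energy `κ(μ,ν) := ∬ κ(x,y) d(μ⊗ν)(x,y)`. -/
noncomputable def energy (κ : X → X → ℝ≥0∞) (μ ν : Measure X) : ℝ≥0∞ :=
  ∫⁻ x, pot κ ν x ∂μ

/-- A positive Radon measure: locally finite and inner regular. -/
def IsRadon (μ : Measure X) : Prop :=
  μ.InnerRegular ∧ IsLocallyFiniteMeasure μ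

/-- `E⁺`: the positive Radon measures of finite energy. -/
def Eplus (κ : X → X → ℝ≥0∞) : Set (Measure X) :=
  {μ | IsRadon μ ∧ energy κ μ μ < ⊤}

/-- `μ` is concentrated on `A`: `A` is `μ`-measurable and `X∖A` is locally `μ`-negligible. -/
def ConcOn (μ : Measure X) (A : Set X) : Prop :=
  NullMeasurableSet A μ ∧ ∀ K : Set X, IsCompact K → μ (Aᶜ ∩ K) = 0

/-- `E⁺_A`: measures of finite energy concentrated on `A`. -/
def EplusOn (κ : X → X → ℝ≥0∞) (A : Set X) : Set (Measure X) :=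
  {μ ∈ Eplus κ | ConcOn μ A}

/-- The inner capacity `c_*(A)`. -/
noncomputable def innerCap (κ : X → X → ℝ≥0∞) (A : Set X) : ℝ≥0∞ :=
  (⨅ μ ∈ {μ ∈ EplusOn κ A | μ Set.univ = 1}, energy κ μ μ)⁻¹

/-- `P` holds nearly everywhere on `A`: the set where it fails has inner capacity zero. -/
def NEOn (κ : X → X → ℝ≥0∞) (A : Set X) (P : X → Prop) : Prop :=
  innerCap κ {x | x ∈ A ∧ ¬ P x} = 0

/-- The outer capacity `c^*(A)`. -/
noncomputable def outerCap (κ : X → X → ℝ≥0∞) (A : Set X) : ℝ≥0∞ :=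
  ⨅ D ∈ {D : Set X | IsOpen D ∧ A ⊆ D}, innerCap κ D

/-- `P` holds quasi-everywhere on `A`: the set where it fails has outer capacity zero. -/
def QEOn (κ : X → X → ℝ≥0∞) (A : Set X) (P : X → Prop) : Prop :=
  outerCap κ {x | x ∈ A ∧ ¬ P x} = 0

/-- The class `Λ_{A,μ}` of measures `ν ∈ E⁺` with `κν ≥ κμ` n.e. on `A`. -/
def InnerLam (κ : X → X → ℝ≥0∞) (A : Set X) (μ : Measure X) : Set (Measure X) :=
  {ν ∈ Eplus κ | NEOn κ A (fun x => pot κ μ x ≤ pot κ ν x)}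

/-- The class `Λ*_{A,μ}` of measures `ν ∈ E⁺` with `κν ≥ κμ` q.e. on `A`. -/
def OuterLam (κ : X → X → ℝ≥0∞) (A : Set X) (μ : Measure X) : Set (Measure X) :=
  {ν ∈ Eplus κ | QEOn κ A (fun x => pot κ μ x ≤ pot κ ν x)}

/-- `b` is the inner balayage `μ^A`: the measure of minimal potential in `Λ_{A,μ}`. -/
def IsInnerBal (κ : X → X → ℝ≥0∞) (A : Set X) (μ b : Measure X) : Prop :=
  b ∈ InnerLam κ A μ ∧ ∀ ν ∈ InnerLam κ A μ, ∀ x, pot κ b x ≤ pot κ ν x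

/-- `b` is the outer balayage `μ^{*A}`: the measure of minimal potential in `Λ*_{A,μ}`. -/
def IsOuterBal (κ : X → X → ℝ≥0∞) (A : Set X) (μ b : Measure X) : Prop :=
  b ∈ OuterLam κ A μ ∧ ∀ ν ∈ OuterLam κ A μ, ∀ x, pot κ b x ≤ pot κ ν x

/-- The strong (energy) distance `‖μ − ν‖`. -/
noncomputable def strDist (κ : X → X → ℝ≥0∞) (μ ν : Measure X) : ℝ :=
  Real.sqrt ((energy κ μ μ).toReal - 2 * (energy κ μ ν).toReal + (energy κ ν ν).toReal)

/-- The energy principle (strict positive definiteness). -/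
def EnergyPrinciple (κ : X → X → ℝ≥0∞) : Prop :=
  ∀ μ ∈ Eplus κ, ∀ ν ∈ Eplus κ,
    2 * energy κ μ ν ≤ energy κ μ μ + energy κ ν ν ∧
      (2 * energy κ μ ν = energy κ μ μ + energy κ ν ν → μ = ν)

/-- Vague convergence of a net of measures along a filter. -/
def VagueConv {ι : Type*} (F : Filter ι) (m : ι → Measure X) (ν : Measure X) : Prop :=
  ∀ f : X → ℝ, Continuous f → HasCompactSupport f →
    Tendsto (fun i => ∫ x, f x ∂(m i)) F (nhds (∫ x, f x ∂ν))

/-- A net of measures is strong Cauchy (for the energy metric) along a filter. -/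
def StrongCauchy (κ : X → X → ℝ≥0∞) {ι : Type*} (F : Filter ι) (m : ι → Measure X) : Prop :=
  ∀ ε : ℝ, 0 < ε → ∃ s ∈ F, ∀ i ∈ s, ∀ j ∈ s, strDist κ (m i) (m j) < ε

/-- The consistency principle: every strong Cauchy net in `E⁺` converges strongly
to each of its vague limit points. -/
def Consistent (κ : X → X → ℝ≥0∞) : Prop :=
  ∀ (ι : Type) (F : Filter ι) (m : ι → Measure X), F.NeBot →
    (∀ i, m i ∈ Eplus κ) → StrongCauchy κ F m →
    ∀ ν : Measure X, (∃ G : Filter ι, G ≤ F ∧ G.NeBot ∧ VagueConv G m ν) →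
      Tendsto (fun i => strDist κ (m i) ν) F (nhds 0)

/-- The domination principle. -/
def Domination (κ : X → X → ℝ≥0∞) : Prop :=
  ∀ μ ∈ Eplus κ, ∀ ν ∈ Eplus κ,
    (∀ᵐ x ∂μ, pot κ μ x ≤ pot κ ν x) → ∀ x, pot κ μ x ≤ pot κ ν x

/-- A kernel: symmetric and lower semicontinuous. -/
structure IsKernel (κ : X → X → ℝ≥0∞) : Prop where
  symm : ∀ x y, κ x y = κ y x
  lsc : LowerSemicontinuous (Function.uncurry κ)

/-- `E'_A`: the strong closure of `E⁺_A` within `E⁺`. -/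
def EclosOn (κ : X → X → ℝ≥0∞) (A : Set X) : Set (Measure X) :=
  {ν ∈ Eplus κ | ∀ ε : ℝ, 0 < ε → ∃ μ ∈ EplusOn κ A, strDist κ ν μ < ε}

/-- The (real-valued) potential of the signed measure `λ = lp − lm`. -/
noncomputable def spot (κ : X → X → ℝ≥0∞) (lp lm : Measure X) (x : X) : ℝ :=
  (pot κ lp x).toReal - (pot κ lm x).toReal

/-- Assumption (A2): every `f ∈ C_c(X)` is the limit, uniformly with supports in one fixed
compact set, of a sequence of potentials of signed measures of finite energy that are
continuous and compactly supported. -/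
def A2 (κ : X → X → ℝ≥0∞) : Prop :=
  ∀ f : X → ℝ, Continuous f → HasCompactSupport f →
    ∃ (K : Set X) (lp lm : ℕ → Measure X), IsCompact K ∧ tsupport f ⊆ K ∧
      (∀ j, lp j ∈ Eplus κ ∧ lm j ∈ Eplus κ) ∧
      (∀ j x, pot κ (lp j) x ≠ ⊤ ∨ pot κ (lm j) x ≠ ⊤) ∧
      (∀ j, Continuous (spot κ (lp j) (lm j))) ∧
      (∀ j, tsupport (spot κ (lp j) (lm j)) ⊆ K) ∧
      TendstoUniformly (fun j => spot κ (lp j) (lm j)) f atTop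


set_option linter.unusedSectionVars false

theorem exists_upperSemicontinuous_lt_lintegral {μ : Measure X} [μ.InnerRegular]
    (φ : SimpleFunc X ℝ≥0) : ∀ c < ∫⁻ x, φ x ∂μ, ∃ (K : Set X) (g : X → ℝ≥0∞),
      IsCompact K ∧ UpperSemicontinuous g ∧ (∀ x, g x ≤ φ x) ∧ (∀ x ∉ K, g x = 0) ∧
        (∀ x ∈ K, φ x ≠ 0) ∧ c < ∫⁻ x, g x ∂μ := by
  induction φ using SimpleFunc.induction with
  | const a hs =>
    rename_i s
    intro c hc
    have hφ : ∀ x, ((SimpleFunc.piecewise s hs (SimpleFunc.const X a)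
        (SimpleFunc.const X 0) x : ℝ≥0) : ℝ≥0∞) = s.indicator (fun _ => (a : ℝ≥0∞)) x := by
      intro x
      by_cases hx : x ∈ s <;> simp [hx]
    simp only [hφ] at hc ⊢
    rw [lintegral_indicator_const hs] at hc
    have ha : (a : ℝ≥0∞) ≠ 0 := by
      rintro h
      simp [h] at hc
    have hc' : c / a < μ s := ENNReal.div_lt_of_lt_mul' hc
    obtain ⟨K, hKs, hK, hcK⟩ := hs.exists_lt_isCompact hc'
    refine ⟨K, K.indicator (fun _ => (a : ℝ≥0∞)), hK,
      hK.isClosed.upperSemicontinuous_indicator zero_le,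
      fun x => indicator_le_indicator_of_subset hKs (fun _ => zero_le) x,
      fun x hx => by simp [hx],
      fun x hx => by simpa [hKs hx] using ha, ?_⟩
    rw [lintegral_indicator_const hK.measurableSet]
    rwa [ENNReal.div_lt_iff (Or.inl ha) (Or.inl ENNReal.coe_ne_top), mul_comm] at hcK
  | @add f g hfg hf hg =>
    intro c hc
    have hadd : ∫⁻ x, ((f + g) x : ℝ≥0) ∂μ = ∫⁻ x, f x ∂μ + ∫⁻ x, g x ∂μ := by
      simp only [SimpleFunc.coe_add, Pi.add_apply, ENNReal.coe_add]
      exact lintegral_add_left f.measurable.coe_nnreal_ennreal _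
    rw [hadd] at hc
    rcases eq_or_ne (∫⁻ x, f x ∂μ) 0 with hf0 | hf0
    · rw [hf0, zero_add] at hc
      obtain ⟨K, k, hK, hk, hkg, hkK, hkφ, hck⟩ := hg c hc
      exact ⟨K, k, hK, hk, fun x => (hkg x).trans (by simp), hkK,
        fun x hx => by simp [hkφ x hx], hck⟩
    rcases eq_or_ne (∫⁻ x, g x ∂μ) 0 with hg0 | hg0
    · rw [hg0, add_zero] at hc
      obtain ⟨K, k, hK, hk, hkg, hkK, hkφ, hck⟩ := hf c hc
      exact ⟨K, k, hK, hk, fun x => (hkg x).trans (by simp), hkK,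
        fun x hx => by simp [hkφ x hx], hck⟩
    obtain ⟨a, ha, b, hb, hab⟩ := ENNReal.exists_lt_add_of_lt_add hc hf0 hg0
    obtain ⟨K, k, hK, hk, hkg, hkK, hkφ, hck⟩ := hf a ha
    obtain ⟨L, l, hL, hl, hlg, hlL, hlφ, hcl⟩ := hg b hb
    refine ⟨K ∪ L, fun x => k x + l x, hK.union hL, hk.add hl, fun x => ?_, fun x hx => ?_,
      fun x hx => ?_, ?_⟩
    · simpa using add_le_add (hkg x) (hlg x)
    · simp only [mem_union, not_or] at hx
      simp [hkK x hx.1, hlL x hx.2]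
    · rcases hx with hx | hx
      · simp [hkφ x hx]
      · simp [hlφ x hx]
    · rw [lintegral_add_left hk.measurable]
      exact hab.trans (ENNReal.add_lt_add hck hcl)

theorem exists_isCompact_lt_setLIntegral {μ : Measure X} [μ.InnerRegular] {s : Set X}
    (hs : MeasurableSet s) (f : X → ℝ≥0∞) {c : ℝ≥0∞} (hc : c < ∫⁻ x in s, f x ∂μ) :
    ∃ K ⊆ s, IsCompact K ∧ c < ∫⁻ x in K, f x ∂μ := by
  rw [← lintegral_indicator hs, lintegral_eq_nnreal] at hc
  simp only [lt_iSup_iff] at hc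
  obtain ⟨φ, hφ, hc⟩ := hc
  rw [← SimpleFunc.lintegral_eq_lintegral] at hc
  obtain ⟨K, g, hK, hg, hgφ, hgK, hKφ, hcg⟩ := exists_upperSemicontinuous_lt_lintegral φ c hc
  refine ⟨K, fun x hx => ?_, hK, hcg.trans_le ?_⟩
  · by_contra hxs
    have := hφ x
    simp [hxs, hKφ x hx] at this
  · rw [← lintegral_indicator hK.measurableSet]
    refine lintegral_mono fun x => ?_
    by_cases hx : x ∈ K
    · rw [indicator_of_mem hx]
      exact (hgφ x).trans ((hφ x).trans (indicator_le_self' (fun _ _ => zero_le) x))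
    · simp [hgK x hx]

/-- Radon measures are `τ`-smooth on lower semicontinuous functions. -/
theorem lintegral_iSup_of_directed_lowerSemicontinuous {μ : Measure X} [μ.InnerRegular]
    [IsFiniteMeasureOnCompacts μ] {ι : Type*} [Nonempty ι] {f : ι → X → ℝ≥0∞}
    (hf : ∀ i, LowerSemicontinuous (f i)) (hd : Directed (· ≤ ·) f) :
    ∫⁻ x, ⨆ i, f i x ∂μ = ⨆ i, ∫⁻ x, f i x ∂μ := by
  refine le_antisymm (le_of_forall_lt fun c hc => ?_)
    (iSup_le fun i => lintegral_mono fun x => le_iSup (fun i => f i x) i)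
  rw [lintegral_eq_nnreal] at hc
  simp only [lt_iSup_iff] at hc
  obtain ⟨φ, hφ, hc⟩ := hc
  rw [← SimpleFunc.lintegral_eq_lintegral] at hc
  obtain ⟨K, g, hK, hg, hgφ, hgK, -, hcg⟩ := exists_upperSemicontinuous_lt_lintegral φ c hc
  obtain ⟨ε, hε, hcε⟩ : ∃ ε : ℝ≥0, 0 < ε ∧ c + ε * μ K < ∫⁻ x, g x ∂μ := by
    have hKt : μ K ≠ ⊤ := hK.measure_lt_top.ne
    have hlim : Tendsto (fun ε : ℝ≥0 => c + (ε : ℝ≥0∞) * μ K) (𝓝[>] 0) (𝓝 (c + 0 * μ K)) := by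
      refine Tendsto.const_add c (ENNReal.Tendsto.mul_const ?_ (Or.inr hKt))
      exact (ENNReal.continuous_coe.tendsto 0).mono_left nhdsWithin_le_nhds
    rw [zero_mul, add_zero] at hlim
    obtain ⟨ε, h1, h2⟩ := ((hlim.eventually_lt_const hcg).and self_mem_nhdsWithin).exists
    exact ⟨ε, h2, h1⟩
  obtain ⟨i, hi⟩ : ∃ i, K ⊆ {x | g x < f i x + ε} := by
    refine hK.elim_directed_cover _ (fun i => ?_) (fun x _ => ?_) ?_
    · have hfi : LowerSemicontinuous fun x => f i x + ε := (hf i).add lowerSemicontinuous_const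
      refine isOpen_iff_mem_nhds.2 fun x hx => ?_
      obtain ⟨q, hq1, hq2⟩ := exists_between (show g x < f i x + ε from hx)
      filter_upwards [hg x q hq1, hfi x q hq2] with y h1 h2 using h1.trans h2
    · have hlt : g x < ⨆ i, (f i x + ε) := by
        rw [← ENNReal.iSup_add]
        exact (hgφ x).trans_lt ((ENNReal.lt_add_right ENNReal.coe_ne_top
          (ENNReal.coe_ne_zero.2 hε.ne')).trans_le (add_le_add_left (hφ x) _))
      simpa using lt_iSup_iff.1 hlt
    · intro i j
      obtain ⟨k, hik, hjk⟩ := hd i j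
      exact ⟨k, fun x hx => lt_of_lt_of_le (mem_ofPred.1 hx) (add_le_add_left (hik x) _),
        fun x hx => lt_of_lt_of_le (mem_ofPred.1 hx) (add_le_add_left (hjk x) _)⟩
  have hle : ∫⁻ x, g x ∂μ ≤ ∫⁻ x, f i x ∂μ + ε * μ K := by
    calc ∫⁻ x, g x ∂μ ≤ ∫⁻ x, (f i x + K.indicator (fun _ => (ε : ℝ≥0∞)) x) ∂μ := by
          refine lintegral_mono fun x => ?_
          by_cases hx : x ∈ K
          · simpa [hx] using (hi hx).le
          · simp [hgK x hx]
      _ = _ := by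
          rw [lintegral_add_left (hf i).measurable, lintegral_indicator_const hK.measurableSet]
  refine lt_of_lt_of_le ?_ (le_iSup _ i)
  exact lt_of_add_lt_add_right (hcε.trans_le hle)

theorem innerRegular_restrict {μ : Measure X} [μ.InnerRegular] {s : Set X} (hs : MeasurableSet s) :
    (μ.restrict s).InnerRegular := by
  refine ⟨fun U hU r hr => ?_⟩
  rw [Measure.restrict_apply hU] at hr
  obtain ⟨K, hKU, hK, hrK⟩ := (hU.inter hs).exists_lt_isCompact hr
  refine ⟨K, hKU.trans inter_subset_left, hK, ?_⟩
  rwa [Measure.restrict_apply hK.measurableSet, inter_eq_left.2 (hKU.trans inter_subset_right)]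

/-- The inner regular measure associated with a measure: `A ↦ sup_K μ(A ∩ K)`. -/
noncomputable def essMeasure (μ : Measure X) : Measure X :=
  Measure.ofMeasurable (fun A _ => ⨆ K : TopologicalSpace.Compacts X, μ (A ∩ K)) (by simp) (by
    intro A hA hAd
    have h1 : ∀ K : TopologicalSpace.Compacts X, μ ((⋃ i, A i) ∩ K) = ∑' i, μ (A i ∩ K) := by
      intro K
      rw [iUnion_inter]
      exact measure_iUnion (fun i j hij => (hAd hij).mono inter_subset_left inter_subset_left)
        fun i => (hA i).inter K.isCompact.measurableSet
    simp only [h1, ENNReal.tsum_eq_iSup_sum]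
    rw [iSup_comm]
    refine iSup_congr fun s => ?_
    refine (ENNReal.finsetSum_iSup fun K L => ⟨K ⊔ L, fun i => ?_⟩).symm
    exact ⟨measure_mono (inter_subset_inter_right _ (by simp)),
      measure_mono (inter_subset_inter_right _ (by simp))⟩)

theorem essMeasure_apply (μ : Measure X) {A : Set X} (hA : MeasurableSet A) :
    essMeasure μ A = ⨆ K : TopologicalSpace.Compacts X, μ (A ∩ K) :=
  Measure.ofMeasurable_apply A hA

theorem essMeasure_apply_of_subset (μ : Measure X) {A K : Set X} (hA : MeasurableSet A)
    (hK : IsCompact K) (hAK : A ⊆ K) : essMeasure μ A = μ A := by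
  rw [essMeasure_apply μ hA]
  refine le_antisymm (iSup_le fun L => measure_mono inter_subset_left) ?_
  refine le_iSup_of_le ⟨K, hK⟩ (measure_mono (subset_inter subset_rfl hAK))

theorem isRadon_essMeasure (μ : Measure X) [μ.Regular] : IsRadon (essMeasure μ) := by
  refine ⟨⟨fun U hU r hr => ?_⟩, ⟨fun x => ?_⟩⟩
  · rw [essMeasure_apply μ hU] at hr
    obtain ⟨K, hrK⟩ := lt_iSup_iff.1 hr
    obtain ⟨C, hC, hCc, hrC⟩ := (hU.inter K.isCompact.measurableSet).exists_lt_isCompact_of_ne_top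
      ((measure_mono inter_subset_right).trans_lt K.isCompact.measure_lt_top).ne hrK
    refine ⟨C, hC.trans inter_subset_left, hCc, ?_⟩
    rwa [essMeasure_apply_of_subset μ hCc.measurableSet hCc subset_rfl]
  · obtain ⟨K, hK, hx⟩ := exists_compact_mem_nhds x
    refine ⟨K, hx, ?_⟩
    rw [essMeasure_apply_of_subset μ hK.measurableSet hK subset_rfl]
    exact hK.measure_lt_top

theorem integral_essMeasure (μ : Measure X) {f : X → ℝ} (hf : HasCompactSupport f) :
    ∫ x, f x ∂(essMeasure μ) = ∫ x, f x ∂μ := by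
  have hz : ∀ x, x ∉ tsupport f → f x = 0 := fun x hx => image_eq_zero_of_notMem_tsupport hx
  have hm : (essMeasure μ).restrict (tsupport f) = μ.restrict (tsupport f) := by
    ext A hA
    rw [Measure.restrict_apply hA, Measure.restrict_apply hA,
      essMeasure_apply_of_subset μ (hA.inter (isClosed_tsupport f).measurableSet) hf
        inter_subset_right]
  rw [← setIntegral_eq_integral_of_forall_compl_eq_zero (μ := μ) hz,
    ← setIntegral_eq_integral_of_forall_compl_eq_zero (μ := essMeasure μ) hz, hm]

/-- The nonnegative continuous compactly supported minorants of `f`. -/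
def ccBelow {Y : Type*} [TopologicalSpace Y] (f : Y → ℝ≥0∞) : Set (Y → ℝ) :=
  {g | Continuous g ∧ HasCompactSupport g ∧ (∀ y, 0 ≤ g y) ∧ ∀ y, ENNReal.ofReal (g y) ≤ f y}

instance {Y : Type*} [TopologicalSpace Y] (f : Y → ℝ≥0∞) : Nonempty (ccBelow f) :=
  ⟨0, continuous_const, HasCompactSupport.zero, fun _ => le_rfl, by simp⟩

theorem directed_ccBelow {Y : Type*} [TopologicalSpace Y] (f : Y → ℝ≥0∞) :
    Directed (· ≤ ·) (fun g : ccBelow f => (g : Y → ℝ)) := by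
  rintro ⟨g, hg, hgc, hg0, hgf⟩ ⟨h, hh, hhc, hh0, hhf⟩
  refine ⟨⟨fun y => max (g y) (h y), hg.max hh, ?_, fun y => (hg0 y).trans (le_max_left _ _),
    fun y => ?_⟩, fun y => le_max_left _ _, fun y => le_max_right _ _⟩
  · exact (hgc.comp₂_left hhc (max_self 0) : _)
  · rw [ENNReal.ofReal_max]
    exact max_le (hgf y) (hhf y)

theorem iSup_ccBelow {Y : Type*} [TopologicalSpace Y] [T2Space Y] [LocallyCompactSpace Y]
    {f : Y → ℝ≥0∞} (hf : LowerSemicontinuous f) (y : Y) :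
    ⨆ g : ccBelow f, ENNReal.ofReal ((g : Y → ℝ) y) = f y := by
  refine le_antisymm (iSup_le fun g => g.2.2.2.2 y) (le_of_forall_lt fun c hc => ?_)
  obtain ⟨d, hcd, hdf⟩ := ENNReal.lt_iff_exists_nnreal_btwn.1 hc
  obtain ⟨φ, hφ1, hφc, hφs, hφ⟩ := exists_continuousMap_one_of_isCompact_subset_isOpen
    (isCompact_singleton (x := y)) (hf.isOpen_preimage d) (by simpa using hdf)
  refine lt_iSup_iff.2 ⟨⟨fun z => d * φ z, by fun_prop, HasCompactSupport.mul_left hφc,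
    fun z => mul_nonneg d.2 (hφ z).1, fun z => ?_⟩, ?_⟩
  · by_cases hz : z ∈ tsupport φ
    · calc ENNReal.ofReal (d * φ z) ≤ ENNReal.ofReal d :=
            ENNReal.ofReal_le_ofReal (mul_le_of_le_one_right d.2 (hφ z).2)
        _ = d := ENNReal.ofReal_coe_nnreal
        _ ≤ f z := le_of_lt (hφs hz)
    · simp [image_eq_zero_of_notMem_tsupport hz]
  · have : φ y = 1 := hφ1 rfl
    simpa [this] using hcd

theorem lowerSemicontinuous_ofReal_comp {Y : Type*} [TopologicalSpace Y] {g : Y → ℝ}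
    (hg : Continuous g) : LowerSemicontinuous fun y => ENNReal.ofReal (g y) :=
  (ENNReal.continuous_ofReal.comp hg).lowerSemicontinuous

theorem lintegral_eq_iSup_ccBelow {μ : Measure X} (hμ : IsRadon μ) {f : X → ℝ≥0∞}
    (hf : LowerSemicontinuous f) :
    ∫⁻ x, f x ∂μ = ⨆ g : ccBelow f, ENNReal.ofReal (∫ x, (g : X → ℝ) x ∂μ) := by
  have := hμ.1
  have := hμ.2
  simp_rw [← iSup_ccBelow hf]
  rw [lintegral_iSup_of_directed_lowerSemicontinuous
    (fun g => lowerSemicontinuous_ofReal_comp g.2.1)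
    (fun g h => by
      obtain ⟨k, hgk, hhk⟩ := directed_ccBelow f g h
      exact ⟨k, fun x => ENNReal.ofReal_le_ofReal (hgk x),
        fun x => ENNReal.ofReal_le_ofReal (hhk x)⟩)]
  refine iSup_congr fun g => ?_
  rw [ofReal_integral_eq_lintegral_ofReal (g.2.1.integrable_of_hasCompactSupport g.2.2.1)
    (Eventually.of_forall g.2.2.2.1)]

/-- The integral of a nonnegative lower semicontinuous function is vaguely lower semicontinuous. -/
theorem lintegral_le_of_vagueConv {ι : Type*} {G : Filter ι} [G.NeBot] {m : ι → Measure X}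
    {b : Measure X} (hm : ∀ i, IsRadon (m i)) (hb : IsRadon b) (hv : VagueConv G m b)
    {f : X → ℝ≥0∞} (hf : LowerSemicontinuous f) {c : ℝ≥0∞} (hc : ∀ i, ∫⁻ x, f x ∂(m i) ≤ c) :
    ∫⁻ x, f x ∂b ≤ c := by
  rw [lintegral_eq_iSup_ccBelow hb hf]
  refine iSup_le fun g => ?_
  refine le_of_tendsto (ENNReal.tendsto_ofReal (hv g g.2.1 g.2.2.1)) (Eventually.of_forall fun i => ?_)
  refine le_trans ?_ (hc i)
  rw [lintegral_eq_iSup_ccBelow (hm i) hf]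
  exact le_iSup (fun g : ccBelow f => ENNReal.ofReal (∫ x, (g : X → ℝ) x ∂(m i))) g

theorem hasCompactSupport_slice {g : X × X → ℝ} (hc : HasCompactSupport g) (x : X) :
    HasCompactSupport fun y => g (x, y) := by
  refine HasCompactSupport.intro (hc.image continuous_snd) fun y hy => ?_
  by_contra h
  exact hy ⟨(x, y), subset_tsupport _ h, rfl⟩

theorem continuous_integral_slice {μ : Measure X} [IsFiniteMeasureOnCompacts μ] {g : X × X → ℝ}
    (hg : Continuous g) (hc : HasCompactSupport g) : Continuous fun x => ∫ y, g (x, y) ∂μ := by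
  rw [← continuousOn_univ]
  refine continuousOn_integral_of_compact_support (f := fun x y => g (x, y))
    (hc.image continuous_snd) hg.continuousOn fun x y _ hy => ?_
  by_contra h
  exact hy ⟨(x, y), subset_tsupport _ h, rfl⟩

variable {κ : X → X → ℝ≥0∞} {μ ν σ b : Measure X}

theorem pot_eq_iSup (hker : IsKernel κ) (hμ : IsRadon μ) (x : X) :
    pot κ μ x = ⨆ g : ccBelow (Function.uncurry κ),
      ENNReal.ofReal (∫ y, (g : X × X → ℝ) (x, y) ∂μ) := by
  have := hμ.1
  have := hμ.2
  have h1 : ∀ y, κ x y = ⨆ g : ccBelow (Function.uncurry κ),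
      ENNReal.ofReal ((g : X × X → ℝ) (x, y)) := fun y => (iSup_ccBelow hker.lsc (x, y)).symm
  simp_rw [pot, h1]
  rw [lintegral_iSup_of_directed_lowerSemicontinuous
    (fun g => lowerSemicontinuous_ofReal_comp (g.2.1.comp (Continuous.prodMk_right x)))
    (fun g h => by
      obtain ⟨k, hgk, hhk⟩ := directed_ccBelow _ g h
      exact ⟨k, fun y => ENNReal.ofReal_le_ofReal (hgk _),
        fun y => ENNReal.ofReal_le_ofReal (hhk _)⟩)]
  refine iSup_congr fun g => ?_
  exact (ofReal_integral_eq_lintegral_ofReal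
    ((g.2.1.comp (Continuous.prodMk_right x)).integrable_of_hasCompactSupport
      (hasCompactSupport_slice g.2.2.1 x))
    (Eventually.of_forall fun y => g.2.2.2.1 _)).symm

theorem lowerSemicontinuous_pot (hker : IsKernel κ) (hμ : IsRadon μ) :
    LowerSemicontinuous (pot κ μ) := by
  have := hμ.2
  have : pot κ μ = fun x => ⨆ g : ccBelow (Function.uncurry κ),
      ENNReal.ofReal (∫ y, (g : X × X → ℝ) (x, y) ∂μ) := funext (pot_eq_iSup hker hμ)
  rw [this]
  exact lowerSemicontinuous_iSup fun g =>
    lowerSemicontinuous_ofReal_comp (continuous_integral_slice g.2.1 g.2.2.1)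

theorem measurable_pot (hker : IsKernel κ) (hμ : IsRadon μ) : Measurable (pot κ μ) :=
  (lowerSemicontinuous_pot hker hμ).measurable

theorem energy_eq_iSup (hker : IsKernel κ) (hμ : IsRadon μ) (hν : IsRadon ν) :
    energy κ μ ν = ⨆ g : ccBelow (Function.uncurry κ),
      ENNReal.ofReal (∫ x, ∫ y, (g : X × X → ℝ) (x, y) ∂ν ∂μ) := by
  have := hμ.1
  have := hμ.2
  have := hν.2
  simp_rw [energy, pot_eq_iSup hker hν]
  rw [lintegral_iSup_of_directed_lowerSemicontinuous
    (fun g => lowerSemicontinuous_ofReal_comp (continuous_integral_slice g.2.1 g.2.2.1))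
    (fun g h => by
      obtain ⟨k, hgk, hhk⟩ := directed_ccBelow _ g h
      have hint : ∀ (g : ccBelow (Function.uncurry κ)) (x : X),
          Integrable (fun y => (g : X × X → ℝ) (x, y)) ν := fun g x =>
        (g.2.1.comp (Continuous.prodMk_right x)).integrable_of_hasCompactSupport
          (hasCompactSupport_slice g.2.2.1 x)
      exact ⟨k, fun x => ENNReal.ofReal_le_ofReal
          (integral_mono (hint g x) (hint k x) fun y => hgk _),
        fun x => ENNReal.ofReal_le_ofReal
          (integral_mono (hint h x) (hint k x) fun y => hhk _)⟩)]
  refine iSup_congr fun g => ?_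
  rw [ofReal_integral_eq_lintegral_ofReal]
  · refine (continuous_integral_slice g.2.1 g.2.2.1).integrable_of_hasCompactSupport ?_
    refine HasCompactSupport.intro (g.2.2.1.image continuous_fst) fun x hx => ?_
    refine integral_eq_zero_of_ae (Eventually.of_forall fun y => ?_)
    by_contra h
    exact hx ⟨(x, y), subset_tsupport _ h, rfl⟩
  · exact Eventually.of_forall fun x => integral_nonneg fun y => g.2.2.2.1 _

theorem energy_comm (hker : IsKernel κ) (hμ : IsRadon μ) (hν : IsRadon ν) :
    energy κ μ ν = energy κ ν μ := by
  have := hμ.2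
  have := hν.2
  have key : ∀ {μ ν : Measure X}, IsRadon μ → IsRadon ν → energy κ μ ν ≤ energy κ ν μ := by
    intro μ ν hμ hν
    have := hμ.2
    have := hν.2
    rw [energy_eq_iSup hker hμ hν, energy_eq_iSup hker hν hμ]
    refine iSup_le fun g => ?_
    refine le_iSup_of_le ⟨fun p => (g : X × X → ℝ) p.swap, g.2.1.comp continuous_swap,
      g.2.2.1.comp_homeomorph (Homeomorph.prodComm X X), fun p => g.2.2.2.1 _, fun p => ?_⟩ ?_
    · exact (g.2.2.2.2 p.swap).trans (hker.symm _ _).le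
    · refine ENNReal.ofReal_le_ofReal (le_of_eq ?_)
      exact integral_integral_swap_of_hasCompactSupport (f := fun x y => (g : X × X → ℝ) (x, y))
        g.2.1 g.2.2.1
  exact le_antisymm (key hμ hν) (key hν hμ)

theorem isRadon_dirac (x : X) : IsRadon (Measure.dirac x) := by
  refine ⟨⟨fun U hU r hr => ?_⟩, inferInstance⟩
  by_cases hx : x ∈ U
  · exact ⟨{x}, by simpa using hx, isCompact_singleton, by
      simpa [Measure.dirac_apply' x hU, hx] using hr⟩
  · simp [Measure.dirac_apply' x hU, hx] at hr

theorem isRadon_zero : IsRadon (0 : Measure X) := ⟨inferInstance, inferInstance⟩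

theorem zero_mem_Eplus : (0 : Measure X) ∈ Eplus κ := ⟨isRadon_zero, by simp [energy]⟩

theorem diag_ne_zero (hE : EnergyPrinciple κ) (x : X) : κ x x ≠ 0 := by
  intro h
  have he : energy κ (Measure.dirac x) (Measure.dirac x) = 0 := by simp [energy, pot, h]
  have h0 := (hE (Measure.dirac x) ⟨isRadon_dirac x, by simp [he]⟩ 0 zero_mem_Eplus).2
    (by rw [he]; simp [energy, pot])
  exact NeZero.ne (Measure.dirac x) h0

/-- Sets of measures of bounded energy are vaguely bounded. -/
theorem exists_measure_le_of_energy_le (hker : IsKernel κ) (hE : EnergyPrinciple κ) {M : ℝ≥0∞}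
    (hM : M ≠ ⊤) {K : Set X} (hK : IsCompact K) :
    ∃ C : ℝ≥0∞, C ≠ ⊤ ∧ ∀ ν : Measure X, energy κ ν ν ≤ M → ν K ≤ C := by
  refine hK.induction_on
    (p := fun K => ∃ C : ℝ≥0∞, C ≠ ⊤ ∧ ∀ ν : Measure X, energy κ ν ν ≤ M → ν K ≤ C)
    ⟨0, by simp, by simp⟩ ?_ ?_ fun x hx => ?_
  · rintro s t hst ⟨C, hC, h⟩
    exact ⟨C, hC, fun ν hν => (measure_mono hst).trans (h ν hν)⟩
  · rintro s t ⟨C, hC, h⟩ ⟨D, hD, h'⟩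
    exact ⟨C + D, by simp [hC, hD], fun ν hν =>
      (measure_union_le s t).trans (add_le_add (h ν hν) (h' ν hν))⟩
  · obtain ⟨c, hc0, hc⟩ := ENNReal.lt_iff_exists_nnreal_btwn.1 (pos_iff_ne_zero.2 (diag_ne_zero hE x))
    have hev : {p : X × X | (c : ℝ≥0∞) < κ p.1 p.2} ∈ 𝓝 (x, x) := hker.lsc (x, x) c hc
    rw [nhds_prod_eq, Filter.mem_prod_self_iff] at hev
    obtain ⟨t, ht, hts⟩ := hev
    have htc : ∀ x ∈ t, ∀ y ∈ t, (c : ℝ≥0∞) < κ x y := fun x hx y hy => hts (mk_mem_prod hx hy)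
    obtain ⟨U, hUt, hU, hxU⟩ := mem_nhds_iff.1 ht
    have hc0' : (c : ℝ≥0∞) ≠ 0 := hc0.ne'
    refine ⟨U, nhdsWithin_le_nhds (hU.mem_nhds hxU), 1 + M / c,
      by simp [ENNReal.div_eq_top, hM, hc0'], fun ν hν => ?_⟩
    have h1 : ∀ x ∈ U, c * ν U ≤ pot κ ν x := fun x hx => by
      calc c * ν U = ∫⁻ _ in U, (c : ℝ≥0∞) ∂ν := by simp
        _ ≤ ∫⁻ y in U, κ x y ∂ν :=
          setLIntegral_mono' hU.measurableSet fun y hy => (htc x (hUt hx) y (hUt hy)).le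
        _ ≤ _ := setLIntegral_le_lintegral _ _
    have h2 : c * ν U * ν U ≤ M := by
      calc c * ν U * ν U = ∫⁻ _ in U, (c * ν U) ∂ν := by simp
        _ ≤ ∫⁻ x in U, pot κ ν x ∂ν := setLIntegral_mono' hU.measurableSet h1
        _ ≤ energy κ ν ν := setLIntegral_le_lintegral _ _
        _ ≤ M := hν
    rcases le_total (ν U) 1 with h | h
    · exact h.trans le_self_add
    · refine le_trans ?_ le_add_self
      rw [ENNReal.le_div_iff_mul_le (Or.inl hc0') (Or.inl ENNReal.coe_ne_top)]
      calc ν U * c ≤ ν U * c * ν U := le_mul_of_one_le_right' h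
        _ = c * ν U * ν U := by ring
        _ ≤ M := h2

open CompactlySupported in
/-- Vaguely bounded sets of Radon measures are vaguely relatively compact. -/
theorem exists_vagueConv_ultrafilter {ι : Type*} (U : Ultrafilter ι) {m : ι → Measure X}
    (hm : ∀ i, IsRadon (m i))
    (hb : ∀ K : Set X, IsCompact K → ∃ C : ℝ≥0∞, C ≠ ⊤ ∧ ∀ i, m i K ≤ C) :
    ∃ b : Measure X, IsRadon b ∧ VagueConv (U : Filter ι) m b := by
  have hfin : ∀ i, IsLocallyFiniteMeasure (m i) := fun i => (hm i).2
  have hlim : ∀ f : C_c(X, ℝ), ∃ L : ℝ, Tendsto (fun i => ∫ x, f x ∂(m i)) U (𝓝 L) := by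
    intro f
    obtain ⟨B, hB⟩ := f.hasCompactSupport.exists_bound_of_continuous f.continuous
    obtain ⟨C, hC, hmC⟩ := hb _ f.hasCompactSupport
    have hmem : ∀ i, ∫ x, f x ∂(m i) ∈ Metric.closedBall (0 : ℝ) (|B| * C.toReal) := by
      intro i
      rw [mem_closedBall_zero_iff, ← setIntegral_eq_integral_of_forall_compl_eq_zero
        (s := tsupport f) fun x hx => image_eq_zero_of_notMem_tsupport hx]
      refine (norm_setIntegral_le_of_norm_le_const
        ((hmC i).trans_lt hC.lt_top) fun x _ => (hB x).trans (le_abs_self B)).trans ?_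
      exact mul_le_mul_of_nonneg_left (ENNReal.toReal_mono hC (hmC i)) (abs_nonneg B)
    obtain ⟨L, -, hL⟩ := (isCompact_closedBall (0 : ℝ) (|B| * C.toReal)).ultrafilter_le_nhds
      (U.map fun i => ∫ x, f x ∂(m i))
      (le_principal_iff.2 (Filter.mem_map.2 (univ_mem' hmem)))
    exact ⟨L, hL⟩
  choose L hL using hlim
  have hint : ∀ (f : C_c(X, ℝ)) i, Integrable f (m i) := fun f i =>
    f.continuous.integrable_of_hasCompactSupport f.hasCompactSupport
  let Λ : C_c(X, ℝ) →ₚ[ℝ] ℝ := PositiveLinearMap.mk₀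
    { toFun := L
      map_add' := fun f g => by
        refine tendsto_nhds_unique (hL (f + g)) ?_
        refine ((hL f).add (hL g)).congr fun i => ?_
        exact (integral_add (hint f i) (hint g i)).symm
      map_smul' := fun c f => by
        refine tendsto_nhds_unique (hL (c • f)) ?_
        refine ((hL f).const_smul c).congr fun i => ?_
        exact (integral_smul c _).symm } fun f hf =>
      ge_of_tendsto (hL f) (Eventually.of_forall fun i => integral_nonneg hf)
  refine ⟨essMeasure (RealRMK.rieszMeasure Λ), isRadon_essMeasure _, fun f hf hfc => ?_⟩
  rw [integral_essMeasure _ hfc]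
  have := RealRMK.integral_rieszMeasure Λ ⟨⟨f, hf⟩, hfc⟩
  change ∫ x, f x ∂_ = _ at this
  rw [this]
  exact hL ⟨⟨f, hf⟩, hfc⟩

/-- A vague limit of Radon measures carried by a compact set is carried by that set. -/
theorem measure_compl_eq_zero_of_vagueConv {ι : Type*} {G : Filter ι} [G.NeBot]
    {m : ι → Measure X} {b : Measure X} (hm : ∀ i, IsRadon (m i)) (hb : IsRadon b)
    (hv : VagueConv G m b) {K : Set X} (hK : IsCompact K) (h : ∀ i, m i Kᶜ = 0) : b Kᶜ = 0 := by
  have hl : LowerSemicontinuous (Kᶜ.indicator fun _ => (1 : ℝ≥0∞)) :=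
    hK.isClosed.isOpen_compl.lowerSemicontinuous_indicator zero_le
  have := lintegral_le_of_vagueConv hm hb hv hl (c := 0) fun i => by
    simp [lintegral_indicator_const hK.measurableSet.compl, h i]
  simpa [lintegral_indicator_const hK.measurableSet.compl] using this

theorem IsRadon.add (hμ : IsRadon μ) (hν : IsRadon ν) : IsRadon (μ + ν) := by
  have := hμ.1
  have := hν.1
  have := hμ.2
  have := hν.2
  refine ⟨inferInstance, ⟨fun x => ?_⟩⟩
  obtain ⟨s, hs, hs'⟩ := μ.finiteAt_nhds x
  obtain ⟨t, ht, ht'⟩ := ν.finiteAt_nhds x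
  refine ⟨s ∩ t, inter_mem hs ht, ?_⟩
  rw [Measure.add_apply]
  exact ENNReal.add_lt_top.2 ⟨(measure_mono inter_subset_left).trans_lt hs',
    (measure_mono inter_subset_right).trans_lt ht'⟩

theorem IsRadon.smul (hμ : IsRadon μ) (c : ℝ≥0) : IsRadon (c • μ) := by
  have := hμ.1
  have := hμ.2
  exact ⟨inferInstance, inferInstance⟩

theorem IsRadon.restrict (hμ : IsRadon μ) {s : Set X} (hs : MeasurableSet s) :
    IsRadon (μ.restrict s) := by
  have := hμ.1
  have := hμ.2
  exact ⟨innerRegular_restrict hs, inferInstance⟩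

theorem energy_add_left : energy κ (μ + ν) σ = energy κ μ σ + energy κ ν σ :=
  lintegral_add_measure _ _ _

theorem energy_add_right (hker : IsKernel κ) (hμ : IsRadon μ) :
    energy κ σ (μ + ν) = energy κ σ μ + energy κ σ ν := by
  simp_rw [energy, pot, lintegral_add_measure]
  exact lintegral_add_left (measurable_pot hker hμ) _

theorem energy_smul_left (c : ℝ≥0) : energy κ (c • μ) σ = c * energy κ μ σ := by
  rw [energy, lintegral_smul_measure, ENNReal.smul_def, smul_eq_mul, energy]

theorem energy_smul_right (c : ℝ≥0) : energy κ σ (c • μ) = c * energy κ σ μ := by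
  simp only [energy, pot, lintegral_smul_measure, ENNReal.smul_def, smul_eq_mul]
  exact lintegral_const_mul' _ _ ENNReal.coe_ne_top

theorem energy_ne_top (hE : EnergyPrinciple κ) (hμ : μ ∈ Eplus κ) (hν : ν ∈ Eplus κ) :
    energy κ μ ν ≠ ⊤ := by
  have h := ((hE μ hμ ν hν).1.trans_lt (ENNReal.add_lt_top.2 ⟨hμ.2, hν.2⟩)).ne
  intro h'
  simp [h'] at h

theorem add_mem_Eplus (hker : IsKernel κ) (hE : EnergyPrinciple κ) (hμ : μ ∈ Eplus κ)
    (hν : ν ∈ Eplus κ) : μ + ν ∈ Eplus κ := by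
  refine ⟨hμ.1.add hν.1, ?_⟩
  rw [energy_add_left, energy_add_right hker hμ.1, energy_add_right hker hμ.1]
  simp [lt_top_iff_ne_top, energy_ne_top hE hμ hμ, energy_ne_top hE hμ hν,
    energy_ne_top hE hν hμ, energy_ne_top hE hν hν]

theorem smul_mem_Eplus (hμ : μ ∈ Eplus κ) (c : ℝ≥0) : c • μ ∈ Eplus κ := by
  refine ⟨hμ.1.smul c, ?_⟩
  rw [energy_smul_left, energy_smul_right]
  exact ENNReal.mul_lt_top ENNReal.coe_lt_top (ENNReal.mul_lt_top ENNReal.coe_lt_top hμ.2)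

theorem energy_mono {μ' ν' : Measure X} (h : μ ≤ μ') (h' : ν ≤ ν') :
    energy κ μ ν ≤ energy κ μ' ν' :=
  lintegral_mono' h fun _ => lintegral_mono' h' le_rfl

theorem restrict_mem_Eplus (hμ : μ ∈ Eplus κ) {s : Set X} (hs : MeasurableSet s) :
    μ.restrict s ∈ Eplus κ :=
  ⟨hμ.1.restrict hs, (energy_mono Measure.restrict_le_self Measure.restrict_le_self).trans_lt hμ.2⟩

/-- The real-valued mutual energy. -/
noncomputable def en (κ : X → X → ℝ≥0∞) (μ ν : Measure X) : ℝ := (energy κ μ ν).toReal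

/-- The squared strong distance. -/
noncomputable def sqDist (κ : X → X → ℝ≥0∞) (μ ν : Measure X) : ℝ :=
  en κ μ μ - 2 * en κ μ ν + en κ ν ν

theorem strDist_eq_sqrt : strDist κ μ ν = Real.sqrt (sqDist κ μ ν) := rfl

theorem en_nonneg : 0 ≤ en κ μ ν := ENNReal.toReal_nonneg

theorem en_comm (hker : IsKernel κ) (hμ : μ ∈ Eplus κ) (hν : ν ∈ Eplus κ) :
    en κ μ ν = en κ ν μ := by rw [en, energy_comm hker hμ.1 hν.1, en]

theorem en_add_left (hE : EnergyPrinciple κ) (hμ : μ ∈ Eplus κ) (hν : ν ∈ Eplus κ)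
    (hσ : σ ∈ Eplus κ) : en κ (μ + ν) σ = en κ μ σ + en κ ν σ := by
  rw [en, energy_add_left, ENNReal.toReal_add (energy_ne_top hE hμ hσ) (energy_ne_top hE hν hσ)]
  rfl

theorem en_add_right (hker : IsKernel κ) (hE : EnergyPrinciple κ) (hμ : μ ∈ Eplus κ)
    (hν : ν ∈ Eplus κ) (hσ : σ ∈ Eplus κ) : en κ σ (μ + ν) = en κ σ μ + en κ σ ν := by
  rw [en, energy_add_right hker hμ.1,
    ENNReal.toReal_add (energy_ne_top hE hσ hμ) (energy_ne_top hE hσ hν)]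
  rfl

theorem en_smul_left (c : ℝ≥0) : en κ (c • μ) σ = c * en κ μ σ := by
  simp [en, energy_smul_left]

theorem en_smul_right (c : ℝ≥0) : en κ σ (c • μ) = c * en κ σ μ := by
  simp [en, energy_smul_right]

theorem sqDist_comm (hker : IsKernel κ) (hμ : μ ∈ Eplus κ) (hν : ν ∈ Eplus κ) :
    sqDist κ μ ν = sqDist κ ν μ := by
  rw [sqDist, sqDist, en_comm hker hμ hν]
  ring

theorem sqDist_nonneg (hE : EnergyPrinciple κ) (hμ : μ ∈ Eplus κ) (hν : ν ∈ Eplus κ) :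
    0 ≤ sqDist κ μ ν := by
  have h := ENNReal.toReal_mono (ENNReal.add_lt_top.2 ⟨hμ.2, hν.2⟩).ne (hE μ hμ ν hν).1
  rw [ENNReal.toReal_add hμ.2.ne hν.2.ne, ENNReal.toReal_mul] at h
  simp only [ENNReal.toReal_ofNat] at h
  simp only [sqDist, en]
  linarith

theorem eq_of_sqDist_eq_zero (hE : EnergyPrinciple κ) (hμ : μ ∈ Eplus κ) (hν : ν ∈ Eplus κ)
    (h : sqDist κ μ ν = 0) : μ = ν := by
  refine (hE μ hμ ν hν).2 ?_
  rw [← ENNReal.toReal_eq_toReal_iff' (ENNReal.mul_ne_top (by simp) (energy_ne_top hE hμ hν))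
    (ENNReal.add_lt_top.2 ⟨hμ.2, hν.2⟩).ne, ENNReal.toReal_add hμ.2.ne hν.2.ne, ENNReal.toReal_mul]
  simp only [sqDist, en] at h
  simp only [ENNReal.toReal_ofNat]
  linarith

theorem sqDist_add_smul (hker : IsKernel κ) (hE : EnergyPrinciple κ) (hμ : μ ∈ Eplus κ)
    (hν : ν ∈ Eplus κ) (hσ : σ ∈ Eplus κ) (t : ℝ≥0) :
    sqDist κ μ (ν + t • σ) =
      sqDist κ μ ν + 2 * t * (en κ ν σ - en κ μ σ) + t ^ 2 * en κ σ σ := by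
  have ht := smul_mem_Eplus hσ t
  have hνt := add_mem_Eplus hker hE hν ht
  rw [sqDist, en_add_right hker hE hν ht hμ, en_add_right hker hE hν ht hνt,
    en_add_left hE hν ht hν, en_add_left hE hν ht ht]
  simp only [en_smul_left, en_smul_right, sqDist, en_comm hker hσ hν]
  ring

/-- The Cauchy–Schwarz inequality in the energy space. -/
theorem sq_en_sub_en_le (hker : IsKernel κ) (hE : EnergyPrinciple κ) (hν : ν ∈ Eplus κ)
    (hb : b ∈ Eplus κ) (hσ : σ ∈ Eplus κ) :
    (en κ ν σ - en κ b σ) ^ 2 ≤ sqDist κ ν b * en κ σ σ := by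
  have key : ∀ t : ℝ, 0 ≤ en κ σ σ * (t * t) + 2 * (en κ ν σ - en κ b σ) * t + sqDist κ ν b := by
    intro t
    rcases le_total 0 t with ht | ht
    · lift t to ℝ≥0 using ht
      have h := sqDist_nonneg hE hb (add_mem_Eplus hker hE hν (smul_mem_Eplus hσ t))
      rw [sqDist_add_smul hker hE hb hν hσ, sqDist_comm hker hb hν] at h
      linarith
    · obtain ⟨s, hs⟩ : ∃ s : ℝ≥0, (s : ℝ) = -t := ⟨⟨-t, by linarith⟩, rfl⟩
      have h := sqDist_nonneg hE hν (add_mem_Eplus hker hE hb (smul_mem_Eplus hσ s))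
      rw [sqDist_add_smul hker hE hν hb hσ, hs] at h
      linarith
  have := discrim_le_zero key
  rw [discrim] at this
  linarith

variable {ι : Type*} {l : Filter ι} {m : ι → Measure X}

theorem tendsto_en (hker : IsKernel κ) (hE : EnergyPrinciple κ) (hm : ∀ i, m i ∈ Eplus κ)
    (hb : b ∈ Eplus κ) (h : Tendsto (fun i => sqDist κ (m i) b) l (𝓝 0)) (hσ : σ ∈ Eplus κ) :
    Tendsto (fun i => en κ (m i) σ) l (𝓝 (en κ b σ)) := by
  have h1 : Tendsto (fun i => √(sqDist κ (m i) b * en κ σ σ)) l (𝓝 0) := by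
    simpa using (h.mul_const (en κ σ σ)).sqrt
  rw [tendsto_iff_dist_tendsto_zero]
  refine squeeze_zero (fun _ => dist_nonneg) (fun i => ?_) h1
  rw [Real.dist_eq]
  exact Real.abs_le_sqrt (sq_en_sub_en_le hker hE (hm i) hb hσ)

theorem tendsto_en_self (hker : IsKernel κ) (hE : EnergyPrinciple κ) (hm : ∀ i, m i ∈ Eplus κ)
    (hb : b ∈ Eplus κ) (h : Tendsto (fun i => sqDist κ (m i) b) l (𝓝 0)) :
    Tendsto (fun i => en κ (m i) (m i)) l (𝓝 (en κ b b)) := by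
  have := (h.add ((tendsto_en hker hE hm hb h hb).const_mul 2)).sub_const (en κ b b)
  convert this using 2
  · simp only [sqDist]; ring
  · ring

theorem tendsto_sqDist (hker : IsKernel κ) (hE : EnergyPrinciple κ) (hm : ∀ i, m i ∈ Eplus κ)
    (hb : b ∈ Eplus κ) (h : Tendsto (fun i => sqDist κ (m i) b) l (𝓝 0)) (hσ : σ ∈ Eplus κ) :
    Tendsto (fun i => sqDist κ σ (m i)) l (𝓝 (sqDist κ σ b)) := by
  have := (((tendsto_en hker hE hm hb h hσ).const_mul 2).const_sub (en κ σ σ)).add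
    (tendsto_en_self hker hE hm hb h)
  convert this using 2
  · rw [sqDist, en_comm hker hσ (hm _)]
  · rw [en_comm hker hb hσ]; rfl

theorem concOn_iff {A : Set X} (hν : IsRadon ν) : ConcOn ν A ↔ ν Aᶜ = 0 := by
  have := hν.1
  constructor
  · rintro ⟨h1, h2⟩
    obtain ⟨t, htA, ht, hae⟩ := h1.compl.exists_measurable_subset_ae_eq
    rw [← measure_congr hae, ht.measure_eq_iSup_isCompact]
    simp only [ENNReal.iSup_eq_zero]
    intro K hKt hK
    rw [← h2 K hK, inter_eq_self_of_subset_right (hKt.trans htA)]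
  · intro h
    exact ⟨(NullMeasurableSet.of_null h).of_compl, fun K _ => measure_mono_null inter_subset_left h⟩

theorem mem_EplusOn_iff {A : Set X} : ν ∈ EplusOn κ A ↔ ν ∈ Eplus κ ∧ ν Aᶜ = 0 :=
  and_congr_right fun h => concOn_iff h.1

theorem EplusOn_mono {A B : Set X} (h : A ⊆ B) : EplusOn κ A ⊆ EplusOn κ B := fun ν hν => by
  rw [mem_EplusOn_iff] at hν ⊢
  exact ⟨hν.1, measure_mono_null (compl_subset_compl.2 h) hν.2⟩

theorem zero_mem_EplusOn {A : Set X} : (0 : Measure X) ∈ EplusOn κ A :=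
  mem_EplusOn_iff.2 ⟨zero_mem_Eplus, by simp⟩

theorem add_mem_EplusOn {A : Set X} (hker : IsKernel κ) (hE : EnergyPrinciple κ)
    (hμ : μ ∈ EplusOn κ A) (hν : ν ∈ EplusOn κ A) : μ + ν ∈ EplusOn κ A := by
  rw [mem_EplusOn_iff] at *
  exact ⟨add_mem_Eplus hker hE hμ.1 hν.1, by simp [hμ.2, hν.2]⟩

theorem smul_mem_EplusOn {A : Set X} (hμ : μ ∈ EplusOn κ A) (c : ℝ≥0) : c • μ ∈ EplusOn κ A := by
  rw [mem_EplusOn_iff] at *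
  exact ⟨smul_mem_Eplus hμ.1 c, by simp [hμ.2]⟩

theorem innerCap_eq_zero {N : Set X} (h : ∀ ν ∈ EplusOn κ N, ν univ ≠ 1) : innerCap κ N = 0 := by
  rw [innerCap, ENNReal.inv_eq_zero]
  simp only [iInf_eq_top]
  exact fun ν hν => absurd hν.2 (h ν hν.1)

/-- Measures of finite energy do not charge Borel sets of inner capacity zero. -/
theorem measure_eq_zero_of_innerCap_eq_zero {N S : Set X} (hN : innerCap κ N = 0)
    (hb : b ∈ Eplus κ) (hSN : S ⊆ N) (hS : MeasurableSet S) : b S = 0 := by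
  have := hb.1.1
  have := hb.1.2
  by_contra h0
  obtain ⟨C, hCS, hC, hpos⟩ := hS.exists_lt_isCompact (pos_iff_ne_zero.2 h0)
  have hfin : b C ≠ ⊤ := hC.measure_lt_top.ne
  rw [innerCap, ENNReal.inv_eq_zero] at hN
  simp only [iInf_eq_top] at hN
  have hmem : (b C)⁻¹.toNNReal • b.restrict C ∈ EplusOn κ N := by
    refine smul_mem_EplusOn (mem_EplusOn_iff.2 ⟨restrict_mem_Eplus hb hC.measurableSet, ?_⟩) _
    rw [Measure.restrict_apply' hC.measurableSet,
      (disjoint_compl_left_iff_subset.2 (hCS.trans hSN)).inter_eq, measure_empty]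
  refine hmem.1.2.ne (hN _ ⟨hmem, ?_⟩)
  rw [Measure.smul_apply, Measure.restrict_apply_univ, ENNReal.smul_def, smul_eq_mul,
    ENNReal.coe_toNNReal (ENNReal.inv_ne_top.2 hpos.ne'), ENNReal.inv_mul_cancel hpos.ne' hfin]

/-- A sequence in `E⁺_A` minimizing the strong distance to `μ`, with squared infimum `I`. -/
structure IsMinSeq (κ : X → X → ℝ≥0∞) (A : Set X) (μ : Measure X) (m : ℕ → Measure X) (I : ℝ) :
    Prop where
  mem : ∀ n, m n ∈ EplusOn κ A
  le : ∀ σ ∈ EplusOn κ A, I ≤ sqDist κ μ σ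
  tendsto : Tendsto (fun n => sqDist κ μ (m n)) atTop (𝓝 I)

theorem exists_isMinSeq (hE : EnergyPrinciple κ) (hμ : μ ∈ Eplus κ) (A : Set X) :
    ∃ m I, IsMinSeq κ A μ m I := by
  have hbdd : BddBelow (sqDist κ μ '' EplusOn κ A) :=
    ⟨0, by rintro _ ⟨ν, hν, rfl⟩; exact sqDist_nonneg hE hμ hν.1⟩
  obtain ⟨u, -, hu, hmem⟩ := exists_seq_tendsto_sInf
    (S := sqDist κ μ '' EplusOn κ A) ⟨_, 0, zero_mem_EplusOn, rfl⟩ hbdd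
  choose m hm hmu using hmem
  exact ⟨m, _, hm, fun σ hσ => csInf_le hbdd ⟨σ, hσ, rfl⟩, by simpa only [hmu] using hu⟩

theorem sqDist_smul (hker : IsKernel κ) (hμ : μ ∈ Eplus κ) (hν : ν ∈ Eplus κ) (s : ℝ≥0) :
    sqDist κ μ (s • ν) = en κ μ μ - 2 * s * en κ ν μ + s ^ 2 * en κ ν ν := by
  rw [sqDist]
  simp only [en_smul_left, en_smul_right, en_comm hker hμ hν]
  ring

theorem en_self_le (hE : EnergyPrinciple κ) (hμ : μ ∈ Eplus κ) (hν : ν ∈ Eplus κ) :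
    en κ ν ν ≤ 2 * sqDist κ μ ν + 2 * en κ μ μ := by
  have := sqDist_nonneg hE (smul_mem_Eplus hμ 2) hν
  rw [sqDist] at this ⊢
  simp only [en_smul_left, en_smul_right, NNReal.coe_ofNat] at this
  linarith

theorem sqDist_parallelogram (hker : IsKernel κ) (hE : EnergyPrinciple κ) (hμ : μ ∈ Eplus κ)
    (hν : ν ∈ Eplus κ) (hσ : σ ∈ Eplus κ) :
    sqDist κ ν σ = 2 * sqDist κ μ ν + 2 * sqDist κ μ σ
      - 4 * sqDist κ μ ((1 / 2 : ℝ≥0) • ν + (1 / 2 : ℝ≥0) • σ) := by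
  have hν' := smul_mem_Eplus hν (1 / 2)
  rw [sqDist_add_smul hker hE hμ hν' hσ, sqDist_smul hker hμ hν, sqDist, sqDist, sqDist]
  simp only [en_smul_left, en_comm hker hν hμ]
  push_cast
  ring

theorem energy_le_ofReal (hE : EnergyPrinciple κ) (hμ : μ ∈ Eplus κ) (hν : ν ∈ Eplus κ) {M : ℝ}
    (h : en κ μ ν ≤ M) : energy κ μ ν ≤ ENNReal.ofReal M := by
  rw [← ENNReal.ofReal_toReal (energy_ne_top hE hμ hν)]
  exact ENNReal.ofReal_le_ofReal h

/-- Minimizing sequences converge strongly. -/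
theorem IsMinSeq.exists_limit {A : Set X} {m : ℕ → Measure X} {I : ℝ} (hker : IsKernel κ)
    (hE : EnergyPrinciple κ) (hC : Consistent κ) (hμ : μ ∈ Eplus κ) (h : IsMinSeq κ A μ m I) :
    ∃ b ∈ Eplus κ, Tendsto (fun n => sqDist κ (m n) b) atTop (𝓝 0) ∧
      ∀ K, IsCompact K → (∀ n, m n Kᶜ = 0) → b Kᶜ = 0 := by
  have hm : ∀ n, m n ∈ Eplus κ := fun n => (h.mem n).1
  have hcau : StrongCauchy κ atTop m := by
    intro ε hε
    refine ⟨{n | sqDist κ μ (m n) < I + ε ^ 2 / 5}, h.tendsto.eventually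
      (gt_mem_nhds (by have := sq_pos_of_pos hε; linarith)), fun i hi j hj => ?_⟩
    rw [strDist_eq_sqrt, Real.sqrt_lt' hε, sqDist_parallelogram hker hE hμ (hm i) (hm j)]
    have := h.le _ (add_mem_EplusOn hker hE (smul_mem_EplusOn (h.mem i) (1 / 2))
      (smul_mem_EplusOn (h.mem j) (1 / 2)))
    rw [mem_ofPred_eq] at hi hj
    have := sq_pos_of_pos hε
    linarith
  obtain ⟨B, hB⟩ := h.tendsto.bddAbove_range
  have hself : ∀ n, en κ (m n) (m n) ≤ 2 * B + 2 * en κ μ μ := fun n =>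
    (en_self_le hE hμ (hm n)).trans (by linarith [hB (mem_range_self n)])
  set M := 2 * B + 2 * en κ μ μ with hM
  have hmut : ∀ i j, energy κ (m i) (m j) ≤ ENNReal.ofReal M := fun i j =>
    energy_le_ofReal hE (hm i) (hm j) (by
      have := sqDist_nonneg hE (hm i) (hm j)
      rw [sqDist] at this
      linarith [hself i, hself j])
  obtain ⟨b, hb, hv⟩ := exists_vagueConv_ultrafilter (hyperfilter ℕ) (fun n => (hm n).1)
    fun K hK => by
      obtain ⟨C, hC, hCK⟩ := exists_measure_le_of_energy_le hker hE ENNReal.ofReal_ne_top hK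
      exact ⟨C, hC, fun n => hCK _ (hmut n n)⟩
  have hbm : ∀ k, energy κ b (m k) ≤ ENNReal.ofReal M := fun k =>
    lintegral_le_of_vagueConv (fun n => (hm n).1) hb hv (lowerSemicontinuous_pot hker (hm k).1)
      fun i => hmut i k
  have hbb : energy κ b b ≤ ENNReal.ofReal M :=
    lintegral_le_of_vagueConv (fun n => (hm n).1) hb hv (lowerSemicontinuous_pot hker hb)
      fun i => (energy_comm hker (hm i).1 hb).trans_le (hbm i)
  have hbE : b ∈ Eplus κ := ⟨hb, hbb.trans_lt ENNReal.ofReal_lt_top⟩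
  refine ⟨b, hbE, ?_, fun K hK h0 =>
    measure_compl_eq_zero_of_vagueConv (fun n => (hm n).1) hb hv hK h0⟩
  have hlim := (hC ℕ atTop m inferInstance hm hcau b
    ⟨hyperfilter ℕ, Nat.hyperfilter_le_atTop, inferInstance, hv⟩).pow 2
  rw [zero_pow two_ne_zero] at hlim
  refine hlim.congr fun n => ?_
  rw [strDist_eq_sqrt, Real.sq_sqrt (sqDist_nonneg hE (hm n) hbE)]

section Variational

variable {A : Set X} {m : ℕ → Measure X} {I : ℝ}

theorem IsMinSeq.sqDist_eq (hker : IsKernel κ) (hE : EnergyPrinciple κ) (hμ : μ ∈ Eplus κ)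
    (h : IsMinSeq κ A μ m I) (hb : b ∈ Eplus κ)
    (hlim : Tendsto (fun n => sqDist κ (m n) b) atTop (𝓝 0)) : sqDist κ μ b = I :=
  tendsto_nhds_unique (tendsto_sqDist hker hE (fun n => (h.mem n).1) hb hlim hμ) h.tendsto

theorem IsMinSeq.en_le (hker : IsKernel κ) (hE : EnergyPrinciple κ) (hμ : μ ∈ Eplus κ)
    (h : IsMinSeq κ A μ m I) (hb : b ∈ Eplus κ)
    (hlim : Tendsto (fun n => sqDist κ (m n) b) atTop (𝓝 0)) (hσ : σ ∈ EplusOn κ A) :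
    en κ μ σ ≤ en κ b σ := by
  have key : ∀ t : ℝ≥0, I ≤ I + 2 * t * (en κ b σ - en κ μ σ) + t ^ 2 * en κ σ σ := fun t => by
    refine ge_of_tendsto ((h.tendsto.add
      (((tendsto_en hker hE (fun n => (h.mem n).1) hb hlim hσ.1).sub_const _).const_mul
        (2 * (t : ℝ)))).add_const _) (Eventually.of_forall fun n => ?_)
    rw [← sqDist_add_smul hker hE hμ (h.mem n).1 hσ.1]
    exact h.le _ (add_mem_EplusOn hker hE (h.mem n) (smul_mem_EplusOn hσ t))
  by_contra! hlt
  set D := en κ μ σ - en κ b σ with hD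
  have hDpos : 0 < D := by linarith
  have he : 0 ≤ en κ σ σ := en_nonneg
  have := key (D / (en κ σ σ + 1)).toNNReal
  rw [Real.coe_toNNReal _ (by positivity)] at this
  set t := D / (en κ σ σ + 1) with ht
  have htpos : 0 < t := by positivity
  have hte : t * (en κ σ σ + 1) = D := by rw [ht]; field_simp
  have : t * (t * en κ σ σ - 2 * D) ≥ 0 := by rw [hD]; nlinarith
  have := nonneg_of_mul_nonneg_right this htpos
  nlinarith

theorem IsMinSeq.en_eq (hker : IsKernel κ) (hE : EnergyPrinciple κ) (hμ : μ ∈ Eplus κ)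
    (h : IsMinSeq κ A μ m I) (hb : b ∈ Eplus κ)
    (hlim : Tendsto (fun n => sqDist κ (m n) b) atTop (𝓝 0)) : en κ b μ = en κ b b := by
  have hm : ∀ n, m n ∈ Eplus κ := fun n => (h.mem n).1
  have key : ∀ s : ℝ≥0, I ≤ en κ μ μ - 2 * s * en κ b μ + s ^ 2 * en κ b b := fun s => by
    refine ge_of_tendsto ((((tendsto_en hker hE hm hb hlim hμ).const_mul (2 * (s : ℝ))).const_sub
      (en κ μ μ)).add ((tendsto_en_self hker hE hm hb hlim).const_mul ((s : ℝ) ^ 2)))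
      (Eventually.of_forall fun n => ?_)
    rw [← sqDist_smul hker hμ (hm n)]
    exact h.le _ (smul_mem_EplusOn (h.mem n) s)
  rw [← h.sqDist_eq hker hE hμ hb hlim, sqDist, en_comm hker hμ hb] at key
  have h1 : 0 ≤ en κ b μ := en_nonneg
  have h2 : 0 ≤ en κ b b := en_nonneg
  rcases h2.eq_or_lt with h0 | h0
  · have := key 2
    rw [← h0] at this ⊢
    push_cast at this
    linarith
  · have := key (en κ b μ / en κ b b).toNNReal
    rw [Real.coe_toNNReal _ (by positivity)] at this
    set s := en κ b μ / en κ b b with hs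
    have hse : en κ b μ = s * en κ b b := by rw [hs]; field_simp
    rw [hse] at this ⊢
    have h3 : (s - 1) ^ 2 * en κ b b ≤ 0 := by linarith
    have h4 : s - 1 = 0 := by
      by_contra h5
      have := mul_pos (sq_pos_of_ne_zero h5) h0
      linarith
    rw [sub_eq_zero.1 h4, one_mul]

theorem IsMinSeq.mem_InnerLam (hker : IsKernel κ) (hE : EnergyPrinciple κ) (hμ : μ ∈ Eplus κ)
    (h : IsMinSeq κ A μ m I) (hb : b ∈ Eplus κ)
    (hlim : Tendsto (fun n => sqDist κ (m n) b) atTop (𝓝 0)) : b ∈ InnerLam κ A μ := by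
  refine ⟨hb, innerCap_eq_zero fun ν hν h1 => ?_⟩
  have hνA := EplusOn_mono (fun x hx => hx.1 : {x | x ∈ A ∧ ¬ pot κ μ x ≤ pot κ b x} ⊆ A) hν
  have hle := h.en_le hker hE hμ hb hlim hνA
  rw [en_comm hker hμ hν.1, en_comm hker hb hν.1] at hle
  refine hle.not_gt ((ENNReal.toReal_lt_toReal (energy_ne_top hE hν.1 hb)
    (energy_ne_top hE hν.1 hμ)).2 ?_)
  refine lintegral_strict_mono (fun h0 => by simp [h0] at h1)
    (measurable_pot hker hμ.1).aemeasurable (energy_ne_top hE hν.1 hb) ?_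
  filter_upwards [compl_mem_ae_iff.2 (mem_EplusOn_iff.1 hν).2] with x hx
  rw [compl_compl] at hx
  exact not_le.1 hx.2

end Variational

/-- Measures of finite energy carried by a Borel subset of `A` satisfy the defining inequality of
`Λ_{A,μ}` almost everywhere. -/
theorem ae_pot_le_of_mem_InnerLam {A K : Set X} (hker : IsKernel κ) (hμ : μ ∈ Eplus κ)
    (hν : ν ∈ InnerLam κ A μ) (hb : b ∈ Eplus κ) (hK : MeasurableSet K) (hKA : K ⊆ A)
    (hbK : b Kᶜ = 0) : ∀ᵐ x ∂b, pot κ μ x ≤ pot κ ν x := by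
  have h0 := measure_eq_zero_of_innerCap_eq_zero hν.2 hb
    (S := K ∩ {x | pot κ ν x < pot κ μ x}) (fun x hx => ⟨hKA hx.1, not_le.2 hx.2⟩)
    (hK.inter (measurableSet_lt (measurable_pot hker hν.1.1) (measurable_pot hker hμ.1)))
  filter_upwards [compl_mem_ae_iff.2 hbK, compl_mem_ae_iff.2 h0] with x hx hx'
  rw [compl_compl] at hx
  by_contra hlt
  exact hx' ⟨hx, not_le.1 hlt⟩

/-- On a compact subset of `A` the projection is attained, and its potential is a lower bound
for the potentials of the measures in `Λ_{A,μ}`. -/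
theorem exists_projection_of_isCompact {A K : Set X} (hker : IsKernel κ) (hE : EnergyPrinciple κ)
    (hC : Consistent κ) (hD : Domination κ) (hμ : μ ∈ Eplus κ) (hK : IsCompact K) (hKA : K ⊆ A) :
    ∃ b ∈ EplusOn κ K, (∀ σ ∈ EplusOn κ K, sqDist κ μ b ≤ sqDist κ μ σ) ∧
      ∀ ν ∈ InnerLam κ A μ, ∀ x, pot κ b x ≤ pot κ ν x := by
  obtain ⟨m, I, h⟩ := exists_isMinSeq hE hμ K
  obtain ⟨b, hb, hlim, hbK⟩ := h.exists_limit hker hE hC hμ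
  replace hbK := hbK K hK fun n => (mem_EplusOn_iff.1 (h.mem n)).2
  refine ⟨b, mem_EplusOn_iff.2 ⟨hb, hbK⟩, ?_, fun ν hν => hD b hb ν hν.1 ?_⟩
  · rw [h.sqDist_eq hker hE hμ hb hlim]
    exact h.le
  have hle := ae_pot_le_of_mem_InnerLam hker hμ (h.mem_InnerLam hker hE hμ hb hlim) hb
    hK.measurableSet subset_rfl hbK
  have heq : energy κ b μ = energy κ b b :=
    (ENNReal.toReal_eq_toReal_iff' (energy_ne_top hE hb hμ) (energy_ne_top hE hb hb)).1
      (h.en_eq hker hE hμ hb hlim)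
  filter_upwards [ae_eq_of_ae_le_of_lintegral_le hle (energy_ne_top hE hb hμ)
    (measurable_pot hker hb.1).aemeasurable heq.ge,
    ae_pot_le_of_mem_InnerLam hker hμ hν hb hK.measurableSet hKA hbK] with x hx hx'
  rwa [← hx]

/-- Measures in `E⁺_A` can be replaced by compactly supported ones at little cost. -/
theorem exists_isCompact_sqDist_restrict_le {A : Set X} (hker : IsKernel κ)
    (hE : EnergyPrinciple κ) (hμ : μ ∈ Eplus κ) (hν : ν ∈ EplusOn κ A) {ε : ℝ} (hε : 0 < ε) :
    ∃ K ⊆ A, IsCompact K ∧ sqDist κ μ (ν.restrict K) ≤ sqDist κ μ ν + ε := by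
  have := hν.1.1.1
  have hfin := energy_ne_top hE hν.1 hμ
  have hself : ∀ K : Set X, en κ (ν.restrict K) (ν.restrict K) ≤ en κ ν ν := fun K =>
    ENNReal.toReal_mono hν.1.2.ne
      (energy_mono Measure.restrict_le_self Measure.restrict_le_self)
  suffices ∃ K ⊆ A, IsCompact K ∧ en κ ν μ - ε / 2 ≤ en κ (ν.restrict K) μ by
    obtain ⟨K, hKA, hK, hle⟩ := this
    refine ⟨K, hKA, hK, ?_⟩
    rw [sqDist, sqDist, en_comm hker hμ hν.1,
      en_comm hker hμ (restrict_mem_Eplus hν.1 hK.measurableSet)]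
    linarith [hself K]
  rcases eq_or_ne (energy κ ν μ) 0 with h0 | h0
  · refine ⟨∅, empty_subset _, isCompact_empty, ?_⟩
    have : en κ ν μ = 0 := by simp [en, h0]
    rw [this]
    have : 0 ≤ en κ (ν.restrict ∅) μ := en_nonneg
    linarith
  set S := (toMeasurable ν Aᶜ)ᶜ with hS
  have hSA : S ⊆ A := compl_subset_comm.1 (subset_toMeasurable _ _)
  have hSν : ν.restrict S = ν := by
    refine Measure.restrict_eq_self_of_ae_mem (compl_mem_ae_iff.2 ?_)
    rw [measure_toMeasurable]
    exact (mem_EplusOn_iff.1 hν).2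
  have hlt : energy κ ν μ - ENNReal.ofReal (ε / 2) < ∫⁻ x in S, pot κ μ x ∂ν := by
    rw [hSν]
    exact ENNReal.sub_lt_self hfin h0 (by simpa using hε)
  obtain ⟨K, hKS, hK, hlt⟩ := exists_isCompact_lt_setLIntegral
    (measurableSet_toMeasurable _ _).compl _ hlt
  refine ⟨K, hKS.trans hSA, hK, ?_⟩
  have := ENNReal.toReal_mono
    (energy_ne_top hE (restrict_mem_Eplus hν.1 hK.measurableSet) hμ) hlt.le
  refine le_trans ?_ this
  have := ENNReal.le_toReal_sub (a := energy κ ν μ) (b := ENNReal.ofReal (ε / 2)) ENNReal.ofReal_ne_top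
  rwa [ENNReal.toReal_ofReal (by positivity)] at this

/-- The strong limit of a suitable minimizing sequence in `E⁺_A` is the inner balayage. -/
theorem exists_isMinSeq_isInnerBal (hker : IsKernel κ) (hE : EnergyPrinciple κ)
    (hC : Consistent κ) (hD : Domination κ) (hμ : μ ∈ Eplus κ) (A : Set X) :
    ∃ m I b, IsMinSeq κ A μ m I ∧ b ∈ Eplus κ ∧
      Tendsto (fun n => sqDist κ (m n) b) atTop (𝓝 0) ∧ IsInnerBal κ A μ b := by
  obtain ⟨m₀, I, h₀⟩ := exists_isMinSeq hE hμ A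
  choose K hKA hK hKm using fun n : ℕ =>
    exists_isCompact_sqDist_restrict_le hker hE hμ (h₀.mem n) (Nat.one_div_pos_of_nat (α := ℝ) (n := n))
  choose m hm hmin hmpot using fun n =>
    exists_projection_of_isCompact hker hE hC hD hμ (hK n) (hKA n)
  have hmA : ∀ n, m n ∈ EplusOn κ A := fun n => EplusOn_mono (hKA n) (hm n)
  have h : IsMinSeq κ A μ m I := by
    refine ⟨hmA, h₀.le, tendsto_of_tendsto_of_tendsto_of_le_of_le tendsto_const_nhds
      (by simpa using h₀.tendsto.add (tendsto_one_div_add_atTop_nhds_zero_nat (𝕜 := ℝ)))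
      (fun n => h₀.le _ (hmA n)) fun n => (hmin n _ ?_).trans (hKm n)⟩
    refine mem_EplusOn_iff.2 ⟨restrict_mem_Eplus (h₀.mem n).1 (hK n).measurableSet, ?_⟩
    rw [Measure.restrict_apply (hK n).measurableSet.compl, compl_inter_self, measure_empty]
  obtain ⟨b, hb, hlim, -⟩ := h.exists_limit hker hE hC hμ
  refine ⟨m, I, b, h, hb, hlim, h.mem_InnerLam hker hE hμ hb hlim, fun ν hν => hD b hb ν hν.1 ?_⟩
  have hS : MeasurableSet {x | pot κ ν x < pot κ b x} :=
    measurableSet_lt (measurable_pot hker hν.1.1) (measurable_pot hker hb.1)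
  have hσ := restrict_mem_Eplus hb hS
  set σ := b.restrict {x | pot κ ν x < pot κ b x} with hσdef
  have hle : energy κ σ b ≤ energy κ σ ν := by
    rw [← ENNReal.toReal_le_toReal (energy_ne_top hE hσ hb) (energy_ne_top hE hσ hν.1)]
    change en κ σ b ≤ en κ σ ν
    rw [en_comm hker hσ hb]
    refine le_of_tendsto (tendsto_en hker hE (fun n => (hmA n).1) hb hlim hσ)
      (Eventually.of_forall fun n => ?_)
    rw [en_comm hker (hmA n).1 hσ]
    exact ENNReal.toReal_mono (energy_ne_top hE hσ hν.1) (lintegral_mono (hmpot n ν hν))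
  have hae : ∀ᵐ x ∂σ, pot κ ν x ≤ pot κ b x := by
    filter_upwards [ae_restrict_mem hS] with x hx using le_of_lt hx
  have := ae_eq_of_ae_le_of_lintegral_le hae (energy_ne_top hE hσ hν.1)
    (measurable_pot hker hb.1).aemeasurable hle
  rw [hσdef, Filter.EventuallyEq, ae_restrict_iff' hS] at this
  filter_upwards [this] with x hx
  by_contra! hlt
  exact hlt.ne (hx hlt)

/-- The obtuse-angle inequality for the strong limit of a minimizing sequence. -/
theorem IsMinSeq.sqDist_add_le {A : Set X} {m : ℕ → Measure X} {I : ℝ} (hker : IsKernel κ)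
    (hE : EnergyPrinciple κ) (hμ : μ ∈ Eplus κ) (h : IsMinSeq κ A μ m I) (hb : b ∈ Eplus κ)
    (hlim : Tendsto (fun n => sqDist κ (m n) b) atTop (𝓝 0)) (hν : ν ∈ EclosOn κ A) :
    sqDist κ μ b + sqDist κ ν b ≤ sqDist κ μ ν := by
  choose s hs hsν using fun n : ℕ => hν.2 _ (Nat.one_div_pos_of_nat (α := ℝ) (n := n))
  have hsE : ∀ n, s n ∈ Eplus κ := fun n => (hs n).1
  have hslim : Tendsto (fun n => sqDist κ (s n) ν) atTop (𝓝 0) := by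
    have h0 := (squeeze_zero (fun n => Real.sqrt_nonneg _) (fun n => (hsν n).le)
      (tendsto_one_div_add_atTop_nhds_zero_nat (𝕜 := ℝ))).pow 2
    rw [zero_pow two_ne_zero] at h0
    refine h0.congr fun n => ?_
    rw [sqDist_comm hker (hsE n) hν.1]
    exact Real.sq_sqrt (sqDist_nonneg hE hν.1 (hsE n))
  have hle : en κ ν μ ≤ en κ ν b :=
    le_of_tendsto_of_tendsto' (tendsto_en hker hE hsE hν.1 hslim hμ)
      (tendsto_en hker hE hsE hν.1 hslim hb) fun n => by
        rw [en_comm hker (hsE n) hμ, en_comm hker (hsE n) hb]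
        exact h.en_le hker hE hμ hb hlim (hs n)
  rw [sqDist, sqDist, sqDist, en_comm hker hμ hb, en_comm hker hμ hν.1,
    h.en_eq hker hE hμ hb hlim]
  linarith

/-- The inner balayage is the orthogonal projection of `μ` onto `E'_A`. -/
theorem statement2 (κ : X → X → ℝ≥0∞) (hker : IsKernel κ)
    (hE : EnergyPrinciple κ) (hC : Consistent κ) (hD : Domination κ) :
    ∀ μ ∈ Eplus κ, ∀ A : Set X,
      ∃ b : Measure X, IsInnerBal κ A μ b ∧ b ∈ EclosOn κ A ∧
        (∀ ν ∈ EclosOn κ A, strDist κ μ b ≤ strDist κ μ ν) ∧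
        (∀ ν ∈ EclosOn κ A, strDist κ μ ν = strDist κ μ b → ν = b) ∧
        IsGLB (strDist κ μ '' EplusOn κ A) (strDist κ μ b) := by
  intro μ hμ A
  obtain ⟨m, I, b, h, hb, hlim, hbal⟩ := exists_isMinSeq_isInnerBal hker hE hC hD hμ A
  have hm : ∀ n, m n ∈ Eplus κ := fun n => (h.mem n).1
  have hsub : EplusOn κ A ⊆ EclosOn κ A := fun ν hν => ⟨hν.1, fun ε hε => ⟨ν, hν, by
    rw [strDist_eq_sqrt, sqDist, two_mul]
    simpa using hε⟩⟩
  have hle := fun ν => h.sqDist_add_le hker hE hμ hb hlim (ν := ν)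
  have hmin : ∀ ν ∈ EclosOn κ A, strDist κ μ b ≤ strDist κ μ ν := fun ν hν =>
    Real.sqrt_le_sqrt <| (le_add_of_nonneg_right (sqDist_nonneg hE hν.1 hb)).trans (hle ν hν)
  refine ⟨b, hbal, ⟨hb, fun ε hε => ?_⟩, hmin, fun ν hν heq => ?_, ?_, fun c hc => ?_⟩
  · obtain ⟨n, hn⟩ := (hlim.eventually (gt_mem_nhds (sq_pos_of_pos hε))).exists
    refine ⟨m n, h.mem n, ?_⟩
    rwa [strDist_eq_sqrt, Real.sqrt_lt' hε, sqDist_comm hker hb (hm n)]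
  · rw [strDist_eq_sqrt, strDist_eq_sqrt,
      Real.sqrt_inj (sqDist_nonneg hE hμ hν.1) (sqDist_nonneg hE hμ hb)] at heq
    exact eq_of_sqDist_eq_zero hE hν.1 hb
      (le_antisymm (by linarith [hle ν hν]) (sqDist_nonneg hE hν.1 hb))
  · rintro _ ⟨ν, hν, rfl⟩
    exact hmin ν (hsub hν)
  · exact ge_of_tendsto (tendsto_sqDist hker hE hm hb hlim hμ).sqrt
      (Eventually.of_forall fun n => hc ⟨m n, h.mem n, rfl⟩)

end Balayage
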